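/- The ideal of ℤ[ζ] generated by 4 + ζ³ (that is, by 4 + i) is maximal, and the quotient ring ℤ[ζ]/(4 + ζ³) is a finite field with exactly 289 elements. -/

import Mathlib

open Polynomial

/-- Up to sign, the remainder of `X ^ 4 - X ^ 2 + 1` modulo `4 + X ^ 3`, over the field with 17
elements. -/
noncomputable def quadraticModSeventeen : (ZMod 17)[X] := X ^ 2 + 4 * X - 1

instance fact_prime_seventeen : Fact (Nat.Prime 17) := ⟨by norm_num⟩

theorem quadraticModSeventeen_eq_C :
    quadraticModSeventeen = C 1 * X ^ 2 + C 4 * X + C (-1) := by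
  rw [quadraticModSeventeen, C_1, C_neg, C_1, show (C 4 : (ZMod 17)[X]) = 4 from rfl]
  ring

theorem quadraticModSeventeen_natDegree : quadraticModSeventeen.natDegree = 2 := by
  rw [quadraticModSeventeen_eq_C]
  exact natDegree_quadratic one_ne_zero

theorem quadraticModSeventeen_monic : quadraticModSeventeen.Monic := by
  rw [Monic, quadraticModSeventeen_eq_C]
  exact leadingCoeff_quadratic one_ne_zero

theorem quadraticModSeventeen_irreducible :
    Irreducible quadraticModSeventeen := by
  have hdeg := quadraticModSeventeen_natDegree
  rw [irreducible_iff_roots_eq_zero_of_degree_le_three hdeg.ge (by lia)]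
  refine Multiset.eq_zero_of_forall_notMem fun a ha => ?_
  have h : a ^ 2 + 4 * a - 1 = 0 := by
    simpa [quadraticModSeventeen, IsRoot] using isRoot_of_mem_roots ha
  exact (by decide : ∀ a : ZMod 17, a ^ 2 + 4 * a - 1 ≠ 0) a h

theorem natCard_adjoinRoot_quadraticModSeventeen :
    Nat.card (AdjoinRoot quadraticModSeventeen) = 289 := by
  let b := (AdjoinRoot.powerBasis' quadraticModSeventeen_monic).basis
  rw [Nat.card_congr b.equivFun.toEquiv]
  simp [quadraticModSeventeen_natDegree]

theorem aeval_quadratic_mem_span {R : Type*} [CommRing R] {ζ : R}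
    (h : ζ ^ 4 - ζ ^ 2 + 1 = 0) (p : ℤ[X])
    (hp : quadraticModSeventeen ∣ p.map (Int.castRingHom (ZMod 17))) :
    aeval ζ p ∈ Ideal.span {(4 + ζ ^ 3 : R)} := by
  have hsurj : Function.Surjective (Int.castRingHom (ZMod 17)) := ZMod.intCast_surjective
  obtain ⟨q, hq⟩ := hp
  obtain ⟨q, rfl⟩ := map_surjective _ hsurj q
  have hker : p - (X ^ 2 + 4 * X - 1) * q ∈
      RingHom.ker (mapRingHom (Int.castRingHom (ZMod 17))) := by
    simp [RingHom.mem_ker, hq, quadraticModSeventeen]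
  rw [ker_mapRingHom, ZMod.ker_intCastRingHom, Ideal.map_span, Set.image_singleton,
    Ideal.mem_span_singleton] at hker
  obtain ⟨r, hr⟩ := hker
  have hp : p = (X ^ 2 + 4 * X - 1) * q + 17 * r := by
    rw [← sub_eq_iff_eq_add', hr]; simp
  rw [Ideal.mem_span_singleton, hp]
  refine ⟨ζ * aeval ζ q + (4 - ζ ^ 3) * aeval ζ r, ?_⟩
  simp only [map_add, map_mul, map_sub, map_pow, aeval_X, map_one, map_ofNat]
  linear_combination (-aeval ζ q + (ζ ^ 2 + 1) * aeval ζ r) * h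

theorem cyclotomic_twelve_eq : cyclotomic 12 ℤ = X ^ 4 - X ^ 2 + 1 := by
  have h := cyclotomic_expand_eq_cyclotomic (p := 2) (n := 6) Nat.prime_two (by norm_num) ℤ
  rw [show 6 * 2 = 12 from rfl, cyclotomic_six] at h
  rw [← h]
  simp [← pow_mul]

theorem IsPrimitiveRoot.cyclotomic_dvd_of_eval₂_eq_zero {K : Type*} [Field K] [CharZero K]
    {n : ℕ} (hn : 0 < n) {ζ : K} (hζ : IsPrimitiveRoot ζ n) {p : ℤ[X]}
    (hp : p.eval₂ (Int.castRingHom K) ζ = 0) : cyclotomic n ℤ ∣ p := by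
  rw [cyclotomic_eq_minpoly hζ hn]
  exact minpoly.isIntegrallyClosed_dvd (hζ.isIntegral hn) hp

theorem IsPrimitiveRoot.cyclotomic_dvd_of_aeval_eq_zero {R : Type*} [CommRing R] [IsDomain R]
    [CharZero R] {n : ℕ} (hn : 0 < n) {ζ : R} (hζ : IsPrimitiveRoot ζ n) {p : ℤ[X]}
    (hp : aeval ζ p = 0) : cyclotomic n ℤ ∣ p := by
  have hinj := IsFractionRing.injective R (FractionRing R)
  have : CharZero (FractionRing R) := charZero_of_injective_algebraMap hinj
  refine (hζ.map_of_injective hinj).cyclotomic_dvd_of_eval₂_eq_zero hn ?_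
  have h := hom_eval₂ p (algebraMap ℤ R) (algebraMap R (FractionRing R)) ζ
  rw [← aeval_def, hp, map_zero] at h
  rw [h]
  congr 1
  exact RingHom.ext_int _ _

theorem ker_mk_comp_aeval_eq {R : Type*} [CommRing R] [IsDomain R] [CharZero R] {ζ : R}
    (hζ : IsPrimitiveRoot ζ 12) (hadj : Algebra.adjoin ℤ {ζ} = ⊤) :
    RingHom.ker ((Ideal.Quotient.mk (Ideal.span {(4 + ζ ^ 3 : R)})).comp
      (aeval ζ : ℤ[X] →ₐ[ℤ] R).toRingHom) =
    RingHom.ker ((AdjoinRoot.mk quadraticModSeventeen).comp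
      (mapRingHom (Int.castRingHom (ZMod 17)))) := by
  have hcyc : aeval ζ (cyclotomic 12 ℤ) = 0 := by
    rw [aeval_def, eval₂_eq_eval_map, map_cyclotomic]
    exact hζ.isRoot_cyclotomic (by norm_num)
  have h : ζ ^ 4 - ζ ^ 2 + 1 = 0 := by
    simpa [cyclotomic_twelve_eq] using hcyc
  ext p
  change Ideal.Quotient.mk _ (aeval ζ p) = 0 ↔ AdjoinRoot.mk _ (p.map _) = 0
  rw [Ideal.Quotient.eq_zero_iff_mem, AdjoinRoot.mk_eq_zero]
  refine ⟨fun hp => ?_, aeval_quadratic_mem_span h p⟩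
  have hsurj : Function.Surjective (aeval ζ : ℤ[X] →ₐ[ℤ] R) := by
    rw [← AlgHom.range_eq_top, ← Algebra.adjoin_singleton_eq_range_aeval, hadj]
  obtain ⟨r, hr⟩ := Ideal.mem_span_singleton.mp hp
  obtain ⟨q, rfl⟩ := hsurj r
  have hdvd : cyclotomic 12 ℤ ∣ p - (4 + X ^ 3) * q :=
    hζ.cyclotomic_dvd_of_aeval_eq_zero (by norm_num) (by simp [hr, map_ofNat])
  obtain ⟨s, hs⟩ := hdvd
  rw [sub_eq_iff_eq_add, cyclotomic_twelve_eq] at hs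
  have h17 : (17 : (ZMod 17)[X]) = 0 := by
    exact_mod_cast CharP.cast_eq_zero (ZMod 17)[X] 17
  refine ⟨(X ^ 2 - 4 * X + 16) * s.map (Int.castRingHom (ZMod 17)) +
    (X - 4) * q.map (Int.castRingHom (ZMod 17)), ?_⟩
  rw [hs, quadraticModSeventeen]
  simp only [Polynomial.map_add, Polynomial.map_mul, Polynomial.map_sub, Polynomial.map_pow,
    map_X, Polynomial.map_one, Polynomial.map_ofNat]
  linear_combination
    ((1 - 4 * X) * s.map (Int.castRingHom (ZMod 17)) + X * q.map (Int.castRingHom (ZMod 17))) * h17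

/-- In `ℤ[ζ]`, `ζ` a primitive 12th root of unity (formalized as: `R` a
characteristic-zero integral domain generated over `ℤ` by a primitive 12th root of unity `ζ`,
so that `R ≅ ℤ[ζ₁₂]`), the ideal generated by `4 + ζ³ = 4 + i` is maximal and the quotient
ring `ℤ[ζ]/(4 + ζ³)` is a finite field with exactly 289 elements. -/
theorem stmt_14 (R : Type*) [CommRing R] [IsDomain R] [CharZero R] (ζ : R)
    (hζ : IsPrimitiveRoot ζ 12) (hadj : Algebra.adjoin ℤ {ζ} = ⊤) :
    (Ideal.span {(4 + ζ ^ 3 : R)}).IsMaximal ∧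
    Nat.card (R ⧸ Ideal.span {(4 + ζ ^ 3 : R)}) = 289 := by
  have : Fact (Irreducible quadraticModSeventeen) := ⟨quadraticModSeventeen_irreducible⟩
  have hsurj : Function.Surjective (aeval ζ : ℤ[X] →ₐ[ℤ] R) := by
    rw [← AlgHom.range_eq_top, ← Algebra.adjoin_singleton_eq_range_aeval, hadj]
  have hsurj₁ : Function.Surjective ((Ideal.Quotient.mk (Ideal.span {(4 + ζ ^ 3 : R)})).comp
      (aeval ζ : ℤ[X] →ₐ[ℤ] R).toRingHom) :=
    Ideal.Quotient.mk_surjective.comp hsurj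
  have hsurj₂ : Function.Surjective ((AdjoinRoot.mk quadraticModSeventeen).comp
      (mapRingHom (Int.castRingHom (ZMod 17)))) :=
    AdjoinRoot.mk_surjective.comp (map_surjective _ ZMod.intCast_surjective)
  let e : (R ⧸ Ideal.span {(4 + ζ ^ 3 : R)}) ≃+* AdjoinRoot quadraticModSeventeen :=
    (RingHom.quotientKerEquivOfSurjective hsurj₁).symm.trans
      ((Ideal.quotEquivOfEq (ker_mk_comp_aeval_eq hζ hadj)).trans
        (RingHom.quotientKerEquivOfSurjective hsurj₂))
  refine ⟨Ideal.Quotient.maximal_of_isField _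
    (e.toMulEquiv.isField (Field.toIsField _)), ?_⟩
  rw [Nat.card_congr e.toEquiv, natCard_adjoinRoot_quadraticModSeventeen]
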